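/- Let α ∈ (0,2), λ ≥ 0, x ∈ ℝ², and let u : ℝ² → ℝ be C⁴. Then there exists a constant C > 0 such that for every h ∈ (0,1], | ∫_{0 < |y| ≤ h} (u(x+y) − u(x) − y·∇u(x)) e^{−λ|y|} |y|^{−(α+2)} dy − (Δu(x)/4) · ∫_{0 < |y| ≤ h} e^{−λ|y|} |y|^{−α} dy | ≤ C h^{4−α}, where Δu(x) denotes the Laplacian of u at x. In particular the small-jump contribution to the nonlocal operator equals a multiple of the Laplacian up to an error of order h^{4−α}. -/

import Mathlib

open MeasureTheory Set

section Taylor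

variable {E : Type*} [NormedAddCommGroup E] [NormedSpace ℝ E]

theorem iteratedDeriv_comp_add_smul {u : E → ℝ} {n : ℕ} (hu : ContDiff ℝ n u) (x y : E)
    {k : ℕ} (hk : k ≤ n) (t : ℝ) :
    iteratedDeriv k (fun s : ℝ => u (x + s • y)) t =
      iteratedFDeriv ℝ k u (x + t • y) fun _ => y := by
  have hv : ContDiff ℝ n (fun z => u (x + z)) := hu.comp (by fun_prop)
  have h := (ContinuousLinearMap.toSpanSingleton ℝ y).iteratedFDeriv_comp_right hv t
    (i := k) (by exact_mod_cast hk)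
  rw [iteratedDeriv_eq_iteratedFDeriv]
  change iteratedFDeriv ℝ k ((fun z => u (x + z)) ∘ ContinuousLinearMap.toSpanSingleton ℝ y) t
    (fun _ => 1) = _
  rw [h]
  simp [iteratedFDeriv_comp_add_left]

/-- Taylor's theorem along a segment, with the Lagrange form of the remainder bounded in norm. -/
theorem abs_sub_taylor_le {u : E → ℝ} {n : ℕ} (hu : ContDiff ℝ (n + 1 : ℕ) u) (x y : E) {M : ℝ}
    (hM : ∀ t ∈ Icc (0 : ℝ) 1, ‖iteratedFDeriv ℝ (n + 1) u (x + t • y)‖ ≤ M) :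
    |u (x + y) - ∑ k ∈ Finset.range (n + 1),
      ((k.factorial : ℝ)⁻¹ * iteratedFDeriv ℝ k u x fun _ => y)| ≤ M * ‖y‖ ^ (n + 1) := by
  have hφ : ContDiff ℝ (n + 1 : ℕ) (fun s : ℝ => u (x + s • y)) := hu.comp (by fun_prop)
  obtain ⟨ξ, hξ, h⟩ := taylor_mean_remainder_lagrange_iteratedDeriv (n := n) (x₀ := 0) (x := 1)
    zero_ne_one (by exact_mod_cast hφ.contDiffOn)
  have hξ' : ξ ∈ Icc (0 : ℝ) 1 := by
    simp only [uIoo, zero_le_one, inf_of_le_left, sup_of_le_right] at hξ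
    exact Ioo_subset_Icc_self hξ
  have hsum : taylorWithinEval (fun s : ℝ => u (x + s • y)) n (uIcc 0 1) 0 1 =
      ∑ k ∈ Finset.range (n + 1),
        ((k.factorial : ℝ)⁻¹ * iteratedFDeriv ℝ k u x fun _ => y) := by
    rw [taylor_within_apply]
    refine Finset.sum_congr rfl fun k hk => ?_
    have hk' : k ≤ n + 1 := (Finset.mem_range.1 hk).le
    rw [iteratedDerivWithin_eq_iteratedDeriv (uniqueDiffOn_uIcc zero_ne_one)
      (hφ.of_le (by exact_mod_cast hk')).contDiffAt (by simp),
      iteratedDeriv_comp_add_smul hu x y hk']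
    simp
  rw [hsum, iteratedDeriv_comp_add_smul hu x y le_rfl] at h
  simp only [one_smul, sub_zero, one_pow, mul_one] at h
  rw [h, abs_div, Nat.abs_cast]
  have hb : |iteratedFDeriv ℝ (n + 1) u (x + ξ • y) fun _ => y| ≤ M * ‖y‖ ^ (n + 1) := by
    have := (iteratedFDeriv ℝ (n + 1) u (x + ξ • y)).le_opNorm fun _ => y
    rw [Fin.prod_const] at this
    exact this.trans (mul_le_mul_of_nonneg_right (hM ξ hξ') (by positivity))
  exact (div_le_self (abs_nonneg _) (by exact_mod_cast (n + 1).factorial_pos)).trans hb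

/-- On a closed ball of a finite-dimensional space, a `C^(n+1)` function is within a constant
times `‖y‖ ^ (n + 1)` of its Taylor polynomial of degree `n` at the center. -/
theorem exists_abs_sub_taylor_le [FiniteDimensional ℝ E] {u : E → ℝ} {n : ℕ}
    (hu : ContDiff ℝ (n + 1 : ℕ) u) (x : E) (r : ℝ) :
    ∃ M, 0 ≤ M ∧ ∀ y, ‖y‖ ≤ r → |u (x + y) - ∑ k ∈ Finset.range (n + 1),
      ((k.factorial : ℝ)⁻¹ * iteratedFDeriv ℝ k u x fun _ => y)| ≤ M * ‖y‖ ^ (n + 1) := by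
  have : ProperSpace E := FiniteDimensional.proper ℝ E
  obtain ⟨M, hM⟩ := (isCompact_closedBall x r).exists_bound_of_continuousOn
    (hu.continuous_iteratedFDeriv (m := n + 1) (by exact_mod_cast le_rfl)).continuousOn
  refine ⟨max M 0, le_max_right _ _, fun y hy => abs_sub_taylor_le hu x y fun t ht => ?_⟩
  refine (hM _ ?_).trans (le_max_left _ _)
  simp only [mem_closedBall_iff_norm, add_sub_cancel_left, norm_smul, Real.norm_eq_abs,
    abs_of_nonneg ht.1]
  exact (mul_le_of_le_one_left (norm_nonneg _) ht.2).trans hy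

end Taylor

/-- The rotation of the plane by a quarter turn. -/
noncomputable def quarterTurn : EuclideanSpace ℝ (Fin 2) ≃ₗᵢ[ℝ] EuclideanSpace ℝ (Fin 2) where
  toFun y := !₂[-y 1, y 0]
  invFun y := !₂[y 1, -y 0]
  map_add' y z := by ext i; fin_cases i <;> simp [add_comm]
  map_smul' c y := by ext i; fin_cases i <;> simp
  left_inv y := by ext i; fin_cases i <;> simp
  right_inv y := by ext i; fin_cases i <;> simp
  norm_map' y := by simp [EuclideanSpace.norm_eq, Fin.sum_univ_two, add_comm]

theorem quarterTurn_apply (y : EuclideanSpace ℝ (Fin 2)) : quarterTurn y = !₂[-y 1, y 0] := rfl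

theorem quarterTurn_quarterTurn (y : EuclideanSpace ℝ (Fin 2)) :
    quarterTurn (quarterTurn y) = -y := by
  ext i; fin_cases i <;> simp [quarterTurn_apply]

/-- A quadratic form summed over two orthogonal vectors of equal length is its trace times their
squared length. -/
theorem iteratedFDeriv_two_add_quarterTurn (u : EuclideanSpace ℝ (Fin 2) → ℝ)
    (x y : EuclideanSpace ℝ (Fin 2)) :
    (iteratedFDeriv ℝ 2 u x fun _ => y) + (iteratedFDeriv ℝ 2 u x fun _ => quarterTurn y) =
      ‖y‖ ^ 2 * ∑ i : Fin 2, iteratedFDeriv ℝ 2 u x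
        ![EuclideanSpace.single i (1:ℝ), EuclideanSpace.single i (1:ℝ)] := by
  have hy : y = y 0 • EuclideanSpace.single 0 (1:ℝ) + y 1 • EuclideanSpace.single 1 (1:ℝ) := by
    ext i; fin_cases i <;> simp
  have hq : quarterTurn y =
      (-y 1) • EuclideanSpace.single 0 (1:ℝ) + y 0 • EuclideanSpace.single 1 (1:ℝ) := by
    ext i; fin_cases i <;> simp [quarterTurn_apply]
  have hn : ‖y‖ ^ 2 = y 0 ^ 2 + y 1 ^ 2 := by
    simp [EuclideanSpace.norm_sq_eq, Fin.sum_univ_two]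
  rw [hn, hq]
  simp only [iteratedFDeriv_two_apply, Fin.sum_univ_two, Matrix.cons_val_zero,
    Matrix.cons_val_one]
  generalize fderiv ℝ (fderiv ℝ u) x = B
  generalize y 0 = a at *
  generalize y 1 = b at *
  subst hy
  simp only [map_add, map_smul, add_apply, smul_apply, smul_eq_mul]
  ring

theorem integrableOn_norm_rpow_closedBall {s : ℝ} (hs : s < 2) (h : ℝ) :
    IntegrableOn (fun y : EuclideanSpace ℝ (Fin 2) => ‖y‖ ^ (-s)) (Metric.closedBall 0 h) := by
  refine IntegrableOn.mono_set ?_ (Metric.closedBall_subset_ball (lt_add_one h))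
  rw [integrableOn_fun_norm_addHaar volume (f := fun r : ℝ => r ^ (-s))]
  rcases le_or_gt (h + 1) 0 with hh | hh
  · simp [Ioo_eq_empty_of_le hh]
  rw [finrank_euclideanSpace_fin]
  refine ((intervalIntegral.integrableOn_Ioo_rpow_iff (s := 1 - s) hh).2
    (by linarith)).congr_fun (fun r hr => ?_) measurableSet_Ioo
  simp [sub_eq_add_neg, Real.rpow_add hr.1]

section PuncturedBall

local notation "Plane" => EuclideanSpace ℝ (Fin 2)

theorem setOf_ne_zero_norm_le_subset (h : ℝ) :
    {y : Plane | y ≠ 0 ∧ ‖y‖ ≤ h} ⊆ Metric.closedBall 0 h :=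
  fun y hy => by simpa using hy.2

theorem measurableSet_ne_zero_norm_le (h : ℝ) :
    MeasurableSet {y : Plane | y ≠ 0 ∧ ‖y‖ ≤ h} :=
  (measurableSet_singleton (0 : Plane)).compl.inter
    (measurableSet_le measurable_norm measurable_const)

theorem measureReal_ne_zero_norm_le_le {h : ℝ} (hh : 0 ≤ h) :
    volume.real {y : Plane | y ≠ 0 ∧ ‖y‖ ≤ h} ≤ Real.pi * h ^ 2 := by
  refine (measureReal_mono (setOf_ne_zero_norm_le_subset h)
    measure_closedBall_lt_top.ne).trans (le_of_eq ?_)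
  simp [Measure.real, hh, mul_comm, Real.pi_nonneg]

theorem preimage_quarterTurn_ne_zero_norm_le (h : ℝ) :
    quarterTurn ⁻¹' {y : Plane | y ≠ 0 ∧ ‖y‖ ≤ h} = {y : Plane | y ≠ 0 ∧ ‖y‖ ≤ h} := by
  ext y
  simp

theorem setIntegral_comp_quarterTurn (G : Plane → ℝ) (h : ℝ) :
    ∫ y in {y : Plane | y ≠ 0 ∧ ‖y‖ ≤ h}, G (quarterTurn y) =
      ∫ y in {y : Plane | y ≠ 0 ∧ ‖y‖ ≤ h}, G y := by
  have := quarterTurn.measurePreserving.setIntegral_preimage_emb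
    quarterTurn.toHomeomorph.measurableEmbedding G {y : Plane | y ≠ 0 ∧ ‖y‖ ≤ h}
  rwa [preimage_quarterTurn_ne_zero_norm_le] at this

theorem integrableOn_comp_quarterTurn {G : Plane → ℝ} {h : ℝ}
    (hG : IntegrableOn G {y : Plane | y ≠ 0 ∧ ‖y‖ ≤ h}) :
    IntegrableOn (fun y => G (quarterTurn y)) {y : Plane | y ≠ 0 ∧ ‖y‖ ≤ h} := by
  have := (quarterTurn.measurePreserving.integrableOn_comp_preimage
    quarterTurn.toHomeomorph.measurableEmbedding).2 hG
  rwa [preimage_quarterTurn_ne_zero_norm_le] at this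

/-- The integral over a punctured disc may be averaged over the four rotations by multiples of a
quarter turn. -/
theorem four_mul_setIntegral_eq {G g : Plane → ℝ} {h : ℝ}
    (hG : IntegrableOn G {y : Plane | y ≠ 0 ∧ ‖y‖ ≤ h})
    (hg : ∀ y, G y + G (-y) + (G (quarterTurn y) + G (-quarterTurn y)) = g y) :
    IntegrableOn g {y : Plane | y ≠ 0 ∧ ‖y‖ ≤ h} ∧
    4 * ∫ y in {y : Plane | y ≠ 0 ∧ ‖y‖ ≤ h}, G y =
      ∫ y in {y : Plane | y ≠ 0 ∧ ‖y‖ ≤ h}, g y := by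
  obtain rfl : (fun y => G y + G (-y) + (G (quarterTurn y) + G (-quarterTurn y))) = g := funext hg
  have hG₁ := integrableOn_comp_quarterTurn hG
  have hG₂ := integrableOn_comp_quarterTurn hG₁
  have hG₃ := integrableOn_comp_quarterTurn hG₂
  have e₁ := setIntegral_comp_quarterTurn G h
  have e₂ := setIntegral_comp_quarterTurn (fun y => G (quarterTurn y)) h
  have e₃ := setIntegral_comp_quarterTurn (fun y => G (quarterTurn (quarterTurn y))) h
  simp only [map_neg, quarterTurn_quarterTurn] at hG₂ hG₃ e₂ e₃
  refine ⟨(hG.add hG₂).add (hG₁.add hG₃), ?_⟩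
  have e := integral_add (hG.add hG₂) (hG₁.add hG₃)
  simp only [Pi.add_apply] at e
  rw [e, integral_add hG hG₂, integral_add hG₁ hG₃, e₃, e₂, e₁]
  ring

theorem integrableOn_exp_mul_norm_rpow {s lam : ℝ} (hs : s < 2) (hlam : 0 ≤ lam) (h : ℝ) :
    IntegrableOn (fun y : Plane => Real.exp (-lam * ‖y‖) * ‖y‖ ^ (-s))
      {y : Plane | y ≠ 0 ∧ ‖y‖ ≤ h} := by
  refine ((integrableOn_norm_rpow_closedBall hs h).mono_set
    (setOf_ne_zero_norm_le_subset h)).mono' (by fun_prop) (ae_of_all _ fun y => ?_)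
  rw [Real.norm_of_nonneg (by positivity)]
  refine mul_le_of_le_one_left (by positivity) (Real.exp_le_one_iff.2 ?_)
  nlinarith [norm_nonneg y]

theorem norm_sq_mul_rpow {y : Plane} (hy : y ≠ 0) (s : ℝ) :
    ‖y‖ ^ 2 * ‖y‖ ^ (-(s + 2)) = ‖y‖ ^ (-s) := by
  rw [← Real.rpow_natCast, ← Real.rpow_add (norm_pos_iff.2 hy)]
  congr 1
  push_cast
  ring

/-- Symmetrized fourth-order Taylor estimate: averaging over quarter turns leaves only the
Laplacian. -/
theorem exists_abs_symmetrized_sub_laplacian_le {u : Plane → ℝ} (hu : ContDiff ℝ 4 u)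
    (x : Plane) : ∃ M, 0 ≤ M ∧ ∀ y, ‖y‖ ≤ 1 →
      |u (x + y) + u (x + -y) + (u (x + quarterTurn y) + u (x + -quarterTurn y)) - 4 * u x -
        ‖y‖ ^ 2 * ∑ i : Fin 2, iteratedFDeriv ℝ 2 u x
          ![EuclideanSpace.single i (1:ℝ), EuclideanSpace.single i (1:ℝ)]| ≤ M * ‖y‖ ^ 4 := by
  obtain ⟨M, hM, hT⟩ := exists_abs_sub_taylor_le (n := 3) (by exact_mod_cast hu) x 1
  refine ⟨4 * M, by positivity, fun y hy => ?_⟩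
  have neg_apply : ∀ (k : ℕ) (z : Plane), (iteratedFDeriv ℝ k u x fun _ => -z) =
      (-1) ^ k * iteratedFDeriv ℝ k u x fun _ => z := fun k z => by
    have := (iteratedFDeriv ℝ k u x).map_smul_univ (fun _ => (-1 : ℝ)) (fun _ => z)
    simpa using this
  have h₀ := hT y hy
  have h₁ := hT (-y) (by simpa using hy)
  have h₂ := hT (quarterTurn y) (by simpa using hy)
  have h₃ := hT (-quarterTurn y) (by simpa using hy)
  rw [← iteratedFDeriv_two_add_quarterTurn]
  simp only [Finset.sum_range_succ, Finset.sum_range_zero, neg_apply, norm_neg,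
    LinearIsometryEquiv.norm_map, iteratedFDeriv_zero_apply, Nat.factorial] at h₀ h₁ h₂ h₃
  norm_num at h₀ h₁ h₂ h₃
  rw [abs_le] at *
  constructor <;> linarith

theorem integrableOn_compensated {α lam : ℝ} (hα : α < 2) (hlam : 0 ≤ lam) {u : Plane → ℝ}
    (hu : ContDiff ℝ 2 u) (x : Plane) (h : ℝ) :
    IntegrableOn (fun y : Plane => (u (x + y) - u x - fderiv ℝ u x y) *
      Real.exp (-lam * ‖y‖) * ‖y‖ ^ (-(α + 2))) {y : Plane | y ≠ 0 ∧ ‖y‖ ≤ h} := by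
  obtain ⟨M, -, hT⟩ := exists_abs_sub_taylor_le (n := 1) (by exact_mod_cast hu) x h
  have hc : Continuous u := hu.continuous
  refine ((integrableOn_exp_mul_norm_rpow hα hlam h).const_mul M).mono' ?_ ?_
  · have hm : Measurable fun y : Plane => u (x + y) - u x - fderiv ℝ u x y :=
      Continuous.measurable (by fun_prop)
    fun_prop
  · refine (ae_restrict_iff' (measurableSet_ne_zero_norm_le h)).2 (ae_of_all _ fun y hy => ?_)
    have hb : |u (x + y) - u x - fderiv ℝ u x y| ≤ M * ‖y‖ ^ 2 := by
      simpa [Finset.sum_range_succ, sub_sub] using hT y hy.2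
    rw [← norm_sq_mul_rpow hy.1 α, norm_mul, norm_mul, Real.norm_eq_abs,
      Real.norm_of_nonneg (Real.exp_pos _).le, Real.norm_of_nonneg (by positivity)]
    calc _ ≤ M * ‖y‖ ^ 2 * Real.exp (-lam * ‖y‖) * ‖y‖ ^ (-(α + 2)) := by gcongr
      _ = _ := by ring

end PuncturedBall

/-- Small-jump approximation by the Laplacian in the two-dimensional isotropic case:
for `α ∈ (0,2)`, `λ ≥ 0`, `x ∈ ℝ²` and `u : ℝ² → ℝ` of class `C⁴`, there is a constant
`C > 0` such that for all `h ∈ (0,1]`, the compensated small-jump integral over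
`0 < |y| ≤ h` differs from `(Δu(x)/4) ∫_{0<|y|≤h} e^{-λ|y|}|y|^{-α} dy` by at most
`C h^{4−α}`. -/
theorem tempered_levy_small_jump_laplacian_approx
    (α lam : ℝ) (hα : α ∈ Ioo (0:ℝ) 2) (hlam : 0 ≤ lam)
    (x : EuclideanSpace ℝ (Fin 2)) (u : EuclideanSpace ℝ (Fin 2) → ℝ)
    (hu : ContDiff ℝ 4 u) :
    ∃ C > 0, ∀ h ∈ Ioc (0:ℝ) 1,
      |(∫ y in {y : EuclideanSpace ℝ (Fin 2) | y ≠ 0 ∧ ‖y‖ ≤ h},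
            (u (x + y) - u x - fderiv ℝ u x y) *
              Real.exp (-lam * ‖y‖) * ‖y‖ ^ (-(α + 2)))
          - ((∑ i : Fin 2,
                iteratedFDeriv ℝ 2 u x
                  ![EuclideanSpace.single i (1:ℝ), EuclideanSpace.single i (1:ℝ)]) / 4) *
              ∫ y in {y : EuclideanSpace ℝ (Fin 2) | y ≠ 0 ∧ ‖y‖ ≤ h},
                Real.exp (-lam * ‖y‖) * ‖y‖ ^ (-α)|
        ≤ C * h ^ (4 - α) := by
  obtain ⟨M, hM, hT⟩ := exists_abs_symmetrized_sub_laplacian_le hu x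
  refine ⟨M * Real.pi / 4 + 1, by positivity, fun h hh => ?_⟩
  obtain ⟨hI, hE⟩ := four_mul_setIntegral_eq
    (integrableOn_compensated hα.2 hlam (hu.of_le (by norm_num)) x h)
    (g := fun y => (u (x + y) + u (x + -y) + (u (x + quarterTurn y) + u (x + -quarterTurn y)) -
      4 * u x) * (Real.exp (-lam * ‖y‖) * ‖y‖ ^ (-(α + 2)))) fun y => by
        simp only [norm_neg, LinearIsometryEquiv.norm_map, map_neg]
        ring
  have hJ := integrableOn_exp_mul_norm_rpow hα.2 hlam h
  set L := ∑ i : Fin 2, iteratedFDeriv ℝ 2 u x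
    ![EuclideanSpace.single i (1:ℝ), EuclideanSpace.single i (1:ℝ)]
  set S := {y : EuclideanSpace ℝ (Fin 2) | y ≠ 0 ∧ ‖y‖ ≤ h}
  have hS_fin : volume S < ⊤ :=
    (measure_mono (setOf_ne_zero_norm_le_subset h)).trans_lt measure_closedBall_lt_top
  have hbound := norm_setIntegral_le_of_norm_le_const (C := M * h ^ (2 - α)) hS_fin
    (f := fun y => (u (x + y) + u (x + -y) + (u (x + quarterTurn y) + u (x + -quarterTurn y)) -
      4 * u x) * (Real.exp (-lam * ‖y‖) * ‖y‖ ^ (-(α + 2))) -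
        L * (Real.exp (-lam * ‖y‖) * ‖y‖ ^ (-α))) fun y hy => ?_
  · rw [integral_sub hI (hJ.const_mul L), integral_const_mul, ← hE, Real.norm_eq_abs] at hbound
    have hpow : h ^ (2 - α) * h ^ 2 = h ^ (4 - α) := by
      rw [← Real.rpow_natCast, ← Real.rpow_add hh.1]
      congr 1
      push_cast
      ring
    have hvol := mul_le_mul_of_nonneg_left (measureReal_ne_zero_norm_le_le hh.1.le)
      (mul_nonneg hM (Real.rpow_nonneg hh.1.le (2 - α)))
    have hpos := Real.rpow_pos_of_pos hh.1 (4 - α)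
    have hfin := hbound.trans hvol
    rw [mul_mul_mul_comm, hpow] at hfin
    rw [abs_le] at hfin ⊢
    constructor <;> linarith
  · have hy0 : 0 < ‖y‖ := norm_pos_iff.2 hy.1
    have hexp : Real.exp (-lam * ‖y‖) ≤ 1 := Real.exp_le_one_iff.2 (by nlinarith)
    have hpow : ‖y‖ ^ 4 * ‖y‖ ^ (-(α + 2)) = ‖y‖ ^ (2 - α) := by
      rw [← Real.rpow_natCast, ← Real.rpow_add hy0]
      congr 1
      push_cast
      ring
    rw [← norm_sq_mul_rpow hy.1 α, mul_left_comm (Real.exp _) (‖y‖ ^ 2), ← mul_assoc L, ← sub_mul,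
      mul_comm L, norm_mul, Real.norm_eq_abs, Real.norm_of_nonneg (by positivity)]
    calc _ ≤ M * ‖y‖ ^ 4 * (1 * ‖y‖ ^ (-(α + 2))) := by
          gcongr
          exact hT y (hy.2.trans hh.2)
      _ = M * ‖y‖ ^ (2 - α) := by rw [one_mul, mul_assoc, hpow]
      _ ≤ M * h ^ (2 - α) := by
          gcongr
          · exact sub_nonneg.2 hα.2.le
          · exact hy.2
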